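/- Under the setup, suppose D₁ ≥ D₀ almost surely, for all d, z ∈ {0,1} the pair (Z, W) is conditionally independent of Y_{d,z} given (D₁, D₀), Z is conditionally independent of (D₁, D₀) given W, P(Z = z, W = w) > 0 for all z, w ∈ {0,1}, P(AT) > 0, P(CP) > 0, E[Y_{1,1} − Y_{1,0} | AT] = ρ₁, and the relevance condition P(AT | W = 1)·P(CP | W = 0) ≠ P(AT | W = 0)·P(CP | W = 1) holds. Then ρ₁ = (r₁(1)·P(CP | W = 0) − r₁(0)·P(CP | W = 1)) / (P(AT | W = 1)·P(CP | W = 0) − P(AT | W = 0)·P(CP | W = 1)), where r₁(w) = E[Y·D | Z = 1, W = w] − E[Y·D | Z = 0, W = w]. -/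

import Mathlib

open MeasureTheory ProbabilityTheory

/-- `pr μ A` is the probability of the event `A`, as a real number. -/
noncomputable def pr {Ω : Type*} [MeasurableSpace Ω] (μ : Measure Ω) (A : Set Ω) : ℝ :=
  (μ A).toReal

/-- `prCond μ A B` is the conditional probability `P(A | B) = P(A ∩ B) / P(B)`. -/
noncomputable def prCond {Ω : Type*} [MeasurableSpace Ω] (μ : Measure Ω) (A B : Set Ω) : ℝ :=
  pr μ (A ∩ B) / pr μ B

/-- `cexp μ A f` is the conditional expectation `E[f | A]` of `f` given the event `A`. -/
noncomputable def cexp {Ω : Type*} [MeasurableSpace Ω] (μ : Measure Ω) (A : Set Ω)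
    (f : Ω → ℝ) : ℝ :=
  ∫ ω, f ω ∂(μ[|A])

/-- The event `{ω | f ω = c}`. -/
def evEq {Ω : Type*} (f : Ω → ℝ) (c : ℝ) : Set Ω := {ω | f ω = c}

/-- Always takers: `D₁ = D₀ = 1`. -/
def ATset {Ω : Type*} (D1 D0 : Ω → ℝ) : Set Ω := {ω | D1 ω = 1 ∧ D0 ω = 1}

/-- Never takers: `D₁ = D₀ = 0`. -/
def NTset {Ω : Type*} (D1 D0 : Ω → ℝ) : Set Ω := {ω | D1 ω = 0 ∧ D0 ω = 0}

/-- Compliers: `D₁ = 1`, `D₀ = 0`. -/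
def CPset {Ω : Type*} (D1 D0 : Ω → ℝ) : Set Ω := {ω | D1 ω = 1 ∧ D0 ω = 0}

theorem cexp_eq_aux {Ω : Type*} [MeasurableSpace Ω] (μ : Measure Ω) (A : Set Ω)
    (f : Ω → ℝ) : cexp μ A f = (pr μ A)⁻¹ * ∫ ω in A, f ω ∂μ := by
  unfold cexp pr ProbabilityTheory.cond
  rw [integral_smul_measure, ENNReal.toReal_inv, smul_eq_mul]

theorem key_aux {Ω : Type*} [MeasurableSpace Ω] (μ : Measure Ω) [IsProbabilityMeasure μ]
    (f D1 D0 Z W : Ω → ℝ) (hf : Measurable f)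
    (hD1m : Measurable D1) (hD0m : Measurable D0) (hZm : Measurable Z) (hWm : Measurable W)
    (i j z w : ℝ) (G : Set Ω) (hG : G = {ω | D1 ω = i ∧ D0 ω = j})
    (h1 : IndepFun (fun ω => (Z ω, W ω)) f (μ[|{ω | D1 ω = i ∧ D0 ω = j}]))
    (h2 : IndepFun Z (fun ω => (D1 ω, D0 ω)) (μ[|evEq W w]))
    (hpos : 0 < pr μ (evEq Z z ∩ evEq W w)) (hGp : 0 < pr μ G) :
    (pr μ (evEq Z z ∩ evEq W w))⁻¹ * ∫ ω in (evEq Z z ∩ evEq W w), G.indicator f ω ∂μ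
      = prCond μ G (evEq W w) * cexp μ G f := by
  rw [← hG] at h1
  have hZs : MeasurableSet (evEq Z z) := hZm (measurableSet_singleton z)
  have hWs : MeasurableSet (evEq W w) := hWm (measurableSet_singleton w)
  have hGs : MeasurableSet G := by
    rw [hG]
    exact (hD1m (measurableSet_singleton i)).inter (hD0m (measurableSet_singleton j))
  have hBs := hZs.inter hWs
  -- independence of the event and the outcome
  have hA : cexp μ G ((evEq Z z ∩ evEq W w).indicator f)
      = (∫ ω, (evEq Z z ∩ evEq W w).indicator (fun _ => (1:ℝ)) ω ∂(μ[|G])) * cexp μ G f := by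
    have hφ : Measurable (({(z, w)} : Set (ℝ × ℝ)).indicator (fun _ => (1:ℝ))) :=
      measurable_const.indicator (measurableSet_singleton _)
    have h := (h1.comp hφ measurable_id).integral_fun_mul_eq_mul_integral
      (hφ.comp (hZm.prodMk hWm)).aestronglyMeasurable hf.aestronglyMeasurable
    have e : (({(z, w)} : Set (ℝ × ℝ)).indicator (fun _ => (1:ℝ))) ∘ (fun ω => (Z ω, W ω))
        = (evEq Z z ∩ evEq W w).indicator (fun _ => (1:ℝ)) := by
      ext ω
      simp only [Function.comp_apply, Set.indicator, evEq, Set.mem_singleton_iff, Prod.mk.injEq,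
        Set.mem_inter_iff, Set.mem_setOf_eq]
    rw [e] at h
    simp only [Function.comp_apply, id_eq] at h
    unfold cexp
    rw [← h]
    congr 1
    ext ω
    by_cases hω : ω ∈ evEq Z z ∩ evEq W w <;> simp [Set.indicator, hω]
  have hc : (∫ ω, (evEq Z z ∩ evEq W w).indicator (fun _ => (1:ℝ)) ω ∂(μ[|G]))
      = (pr μ G)⁻¹ * pr μ ((evEq Z z ∩ evEq W w) ∩ G) := by
    have := cexp_eq_aux μ G ((evEq Z z ∩ evEq W w).indicator (fun _ => (1:ℝ)))
    unfold cexp at this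
    rw [this, integral_indicator_const _ hBs]
    simp [pr, Measure.real, Measure.restrict_apply hBs]
  have hi : ∫ ω in G, (evEq Z z ∩ evEq W w).indicator f ω ∂μ
      = ∫ ω in (evEq Z z ∩ evEq W w), G.indicator f ω ∂μ := by
    rw [setIntegral_indicator hBs, setIntegral_indicator hGs, Set.inter_comm]
  -- independence of Z and the type given W
  have hWp : 0 < pr μ (evEq W w) :=
    hpos.trans_le (ENNReal.toReal_mono (measure_ne_top _ _) (measure_mono Set.inter_subset_right))
  have hB := h2.measure_inter_preimage_eq_mul _ _ (measurableSet_singleton z)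
    (measurableSet_singleton (i, j))
  have e1 : Z ⁻¹' {z} = evEq Z z := rfl
  have e2 : (fun ω => (D1 ω, D0 ω)) ⁻¹' {(i, j)} = G := by
    rw [hG]; ext ω; simp
  rw [e1, e2, cond_apply hWs, cond_apply hWs, cond_apply hWs] at hB
  have hB' := congrArg ENNReal.toReal hB
  simp only [ENNReal.toReal_mul, ENNReal.toReal_inv] at hB'
  rw [show evEq W w ∩ (evEq Z z ∩ G) = (evEq Z z ∩ evEq W w) ∩ G by ext; simp; tauto,
    Set.inter_comm (evEq W w) (evEq Z z), Set.inter_comm (evEq W w) G] at hB'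
  rw [cexp_eq_aux μ G ((evEq Z z ∩ evEq W w).indicator f), hi, hc] at hA
  change (pr μ (evEq W w))⁻¹ * pr μ _ = (pr μ (evEq W w))⁻¹ * pr μ _ *
    ((pr μ (evEq W w))⁻¹ * pr μ _) at hB'
  unfold prCond
  generalize cexp μ G f = c at *
  generalize (∫ ω in (evEq Z z ∩ evEq W w), G.indicator f ω ∂μ) = I at *
  generalize pr μ ((evEq Z z ∩ evEq W w) ∩ G) = a at *
  generalize pr μ (evEq Z z ∩ evEq W w) = b at *
  generalize pr μ (G ∩ evEq W w) = p at *
  generalize pr μ (evEq W w) = q at *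
  generalize pr μ G = g at *
  have hI : I = a * c := by
    field_simp at hA
    exact hA
  field_simp at hB'
  rw [hI]
  field_simp
  linear_combination c * hB'

/-- identification of the direct effect `ρ₁` on the treated outcome. -/
theorem rho1_identified
    {Ω : Type*} [MeasurableSpace Ω] (μ : Measure Ω) [IsProbabilityMeasure μ]
    (Y : Fin 2 → Fin 2 → Ω → ℝ) (D1 D0 Z W : Ω → ℝ)
    (hYint : ∀ d z, Integrable (Y d z) μ) (hYmeas : ∀ d z, Measurable (Y d z))
    (hD1v : ∀ ω, D1 ω = 0 ∨ D1 ω = 1) (hD0v : ∀ ω, D0 ω = 0 ∨ D0 ω = 1)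
    (hZv : ∀ ω, Z ω = 0 ∨ Z ω = 1) (hWv : ∀ ω, W ω = 0 ∨ W ω = 1)
    (hD1m : Measurable D1) (hD0m : Measurable D0) (hZm : Measurable Z) (hWm : Measurable W)
    (D : Ω → ℝ) (hD : ∀ ω, D ω = D1 ω * Z ω + D0 ω * (1 - Z ω))
    (Yo : Ω → ℝ)
    (hYo : ∀ ω, Yo ω = (Y 1 1 ω * Z ω + Y 1 0 ω * (1 - Z ω)) * D ω
      + (Y 0 1 ω * Z ω + Y 0 0 ω * (1 - Z ω)) * (1 - D ω))
    (hmono : ∀ᵐ ω ∂μ, D0 ω ≤ D1 ω)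
    (hCI1 : ∀ (d z : Fin 2) (i j : ℝ),
      IndepFun (fun ω => (Z ω, W ω)) (Y d z) (μ[|{ω | D1 ω = i ∧ D0 ω = j}]))
    (hCI2 : ∀ w' : ℝ, IndepFun Z (fun ω => (D1 ω, D0 ω)) (μ[|evEq W w']))
    (hpos : ∀ z w : ℝ, z = 0 ∨ z = 1 → w = 0 ∨ w = 1 → 0 < pr μ (evEq Z z ∩ evEq W w))
    (hAT : 0 < pr μ (ATset D1 D0)) (hCP : 0 < pr μ (CPset D1 D0))
    (ρ1 : ℝ) (hρ1 : cexp μ (ATset D1 D0) (fun ω => Y 1 1 ω - Y 1 0 ω) = ρ1)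
    (r11 r10 : ℝ)
    (hr11 : r11 = cexp μ (evEq Z 1 ∩ evEq W 1) (fun ω => Yo ω * D ω)
      - cexp μ (evEq Z 0 ∩ evEq W 1) (fun ω => Yo ω * D ω))
    (hr10 : r10 = cexp μ (evEq Z 1 ∩ evEq W 0) (fun ω => Yo ω * D ω)
      - cexp μ (evEq Z 0 ∩ evEq W 0) (fun ω => Yo ω * D ω))
    (hrel : prCond μ (ATset D1 D0) (evEq W 1) * prCond μ (CPset D1 D0) (evEq W 0)
      ≠ prCond μ (ATset D1 D0) (evEq W 0) * prCond μ (CPset D1 D0) (evEq W 1)) :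
    ρ1 = (r11 * prCond μ (CPset D1 D0) (evEq W 0) - r10 * prCond μ (CPset D1 D0) (evEq W 1))
      / (prCond μ (ATset D1 D0) (evEq W 1) * prCond μ (CPset D1 D0) (evEq W 0)
        - prCond μ (ATset D1 D0) (evEq W 0) * prCond μ (CPset D1 D0) (evEq W 1)) := by
  have hATs : MeasurableSet (ATset D1 D0) :=
    (hD1m (measurableSet_singleton 1)).inter (hD0m (measurableSet_singleton 1))
  have hCPs : MeasurableSet (CPset D1 D0) :=
    (hD1m (measurableSet_singleton 1)).inter (hD0m (measurableSet_singleton 0))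
  have hZs : ∀ z, MeasurableSet (evEq Z z) := fun z => hZm (measurableSet_singleton z)
  have hWs : ∀ w, MeasurableSet (evEq W w) := fun w => hWm (measurableSet_singleton w)
  have kA : ∀ z w : ℝ, z = 0 ∨ z = 1 → w = 0 ∨ w = 1 → ∀ k : Fin 2, _ := fun z w hz hw k =>
    key_aux μ (Y 1 k) D1 D0 Z W (hYmeas 1 k) hD1m hD0m hZm hWm 1 1 z w (ATset D1 D0) rfl
      (hCI1 1 k 1 1) (hCI2 w) (hpos z w hz hw) hAT
  have kC : ∀ z w : ℝ, z = 0 ∨ z = 1 → w = 0 ∨ w = 1 → ∀ k : Fin 2, _ := fun z w hz hw k =>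
    key_aux μ (Y 1 k) D1 D0 Z W (hYmeas 1 k) hD1m hD0m hZm hWm 1 0 z w (CPset D1 D0) rfl
      (hCI1 1 k 1 0) (hCI2 w) (hpos z w hz hw) hCP
  have c1 : ∀ w : ℝ, w = 0 ∨ w = 1 →
      cexp μ (evEq Z 1 ∩ evEq W w) (fun ω => Yo ω * D ω)
        = prCond μ (ATset D1 D0) (evEq W w) * cexp μ (ATset D1 D0) (Y 1 1)
          + prCond μ (CPset D1 D0) (evEq W w) * cexp μ (CPset D1 D0) (Y 1 1) := by
    intro w hw
    rw [← kA 1 w (Or.inr rfl) hw 1, ← kC 1 w (Or.inr rfl) hw 1, cexp_eq_aux, ← mul_add,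
      ← integral_add ((hYint 1 1).indicator hATs).integrableOn
        ((hYint 1 1).indicator hCPs).integrableOn]
    congr 1
    refine setIntegral_congr_fun ((hZs 1).inter (hWs w)) ?_
    rintro ω ⟨hz, -⟩
    have hz : Z ω = 1 := hz
    rcases hD1v ω with h1 | h1 <;> rcases hD0v ω with h0 | h0 <;>
      simp [hYo, hD, hz, h1, h0, ATset, CPset, Set.indicator]
  have c0 : ∀ w : ℝ, w = 0 ∨ w = 1 →
      cexp μ (evEq Z 0 ∩ evEq W w) (fun ω => Yo ω * D ω)
        = prCond μ (ATset D1 D0) (evEq W w) * cexp μ (ATset D1 D0) (Y 1 0) := by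
    intro w hw
    rw [← kA 0 w (Or.inl rfl) hw 0, cexp_eq_aux]
    congr 1
    refine setIntegral_congr_ae ((hZs 0).inter (hWs w)) ?_
    filter_upwards [hmono] with ω hm
    rintro ⟨hz, -⟩
    have hz : Z ω = 0 := hz
    rcases hD1v ω with h1 | h1 <;> rcases hD0v ω with h0 | h0 <;>
      first
      | (exfalso; rw [h1, h0] at hm; norm_num at hm; done)
      | simp [hYo, hD, hz, h1, h0, ATset, Set.indicator]
  have hρ : ρ1 = cexp μ (ATset D1 D0) (Y 1 1) - cexp μ (ATset D1 D0) (Y 1 0) := by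
    rw [← hρ1, cexp_eq_aux, cexp_eq_aux, cexp_eq_aux,
      integral_sub (hYint 1 1).integrableOn (hYint 1 0).integrableOn]
    ring
  rw [c1 1 (Or.inr rfl), c0 1 (Or.inr rfl)] at hr11
  rw [c1 0 (Or.inl rfl), c0 0 (Or.inl rfl)] at hr10
  rw [eq_div_iff (sub_ne_zero.mpr hrel), hr11, hr10, hρ]
  ring
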